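/- arXiv:1305.1579 — 2 statements merged into one kernel-verified Lean document; each statement's English description precedes it below -/
import Mathlib

section
/- Suppose β < β₁ = e^{−λ_max(A)}. Then the global attractor of the deterministically forced system equals the zero section: 𝒜_β = Θ × {0}. -/
open Filter MeasureTheory Metric Set
open scoped Topology

noncomputable section

/-- ℝ² with the Euclidean norm. -/
abbrev R2 : Type := EuclideanSpace ℝ (Fin 2)

/-- Action of a 2×2 real matrix on Euclidean ℝ². -/
def mulVecE (M : Matrix (Fin 2) (Fin 2) ℝ) (v : R2) : R2 :=
  (WithLp.equiv 2 (Fin 2 → ℝ)).symm (M.mulVec ((WithLp.equiv 2 (Fin 2 → ℝ)) v))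

/-- Operator norm of a 2×2 real matrix induced by the Euclidean norm on ℝ². -/
def opNorm (M : Matrix (Fin 2) (Fin 2) ℝ) : ℝ :=
  ‖(Matrix.toEuclideanCLM (𝕜 := ℝ) M : R2 →L[ℝ] R2)‖

/-- The cocycle `A_n(θ) = A(γ^{n-1}θ) ⋯ A(θ)`. -/
def coc {Θ : Type*} (γ : Θ → Θ) (A : Θ → Matrix (Fin 2) (Fin 2) ℝ) :
    ℕ → Θ → Matrix (Fin 2) (Fin 2) ℝ
  | 0, _ => 1
  | n + 1, θ => coc γ A n (γ θ) * A θ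

/-- Maximal Lyapunov exponent `λ_max(A) = sup_θ limsup (1/n) log‖A_n(θ)‖`. -/
def lyapMax {Θ : Type*} (γ : Θ → Θ) (A : Θ → Matrix (Fin 2) (Fin 2) ℝ) : ℝ :=
  ⨆ θ : Θ, Filter.limsup (fun n : ℕ => Real.log (opNorm (coc γ A n θ)) / n) Filter.atTop

/-- The hypotheses on `h`: C² on [0,∞), strictly increasing, strictly concave, bounded,
nonnegative, `h 0 = 0`, `h' 0 = 1`. -/
def GoodH (h : ℝ → ℝ) : Prop :=
  ContDiffOn ℝ 2 h (Set.Ici 0) ∧ StrictMonoOn h (Set.Ici 0) ∧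
    StrictConcaveOn ℝ (Set.Ici 0) h ∧ BddAbove (h '' Set.Ici 0) ∧
    (∀ x ∈ Set.Ici (0 : ℝ), 0 ≤ h x) ∧ h 0 = 0 ∧ derivWithin h (Set.Ici 0) 0 = 1

/-- The scaling condition `sup_{x ≥ 0} h(x) ≤ (sup_θ ‖A(θ)‖)⁻¹`. -/
def Scaled {Θ : Type*} (A : Θ → Matrix (Fin 2) (Fin 2) ℝ) (h : ℝ → ℝ) : Prop :=
  ∀ x ∈ Set.Ici (0 : ℝ), h x ≤ (⨆ θ : Θ, opNorm (A θ))⁻¹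

open scoped Classical in
/-- The fibre maps `f_{β,θ}(v) = h(β‖v‖)·A(θ)·v/‖v‖`, `f_{β,θ}(0) = 0`. -/
def fibMap {Θ : Type*} (A : Θ → Matrix (Fin 2) (Fin 2) ℝ) (h : ℝ → ℝ) (β : ℝ)
    (θ : Θ) (v : R2) : R2 :=
  if v = 0 then 0 else (h (β * ‖v‖) / ‖v‖) • mulVecE (A θ) v

/-- The skew product `f_β(θ,v) = (γθ, f_{β,θ}(v))`. -/
def skewProd {Θ : Type*} (γ : Θ → Θ) (A : Θ → Matrix (Fin 2) (Fin 2) ℝ) (h : ℝ → ℝ)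
    (β : ℝ) : Θ × R2 → Θ × R2 :=
  fun p => (γ p.1, fibMap A h β p.1 p.2)

/-- The global attractor `𝒜_β = ⋂_{n∈ℕ} f_β^n(Θ × B̄₁(0))`. -/
def globalAttractor {Θ : Type*} (γ : Θ → Θ) (A : Θ → Matrix (Fin 2) (Fin 2) ℝ)
    (h : ℝ → ℝ) (β : ℝ) : Set (Θ × R2) :=
  ⋂ n : ℕ, (skewProd γ A h β)^[n] '' (Set.univ ×ˢ Metric.closedBall (0 : R2) 1)

/-- The fibre `𝒜_β(θ) = {x : (θ,x) ∈ 𝒜_β}` of the global attractor. -/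
def attractorFib {Θ : Type*} (γ : Θ → Θ) (A : Θ → Matrix (Fin 2) (Fin 2) ℝ)
    (h : ℝ → ℝ) (β : ℝ) (θ : Θ) : Set R2 :=
  {x : R2 | (θ, x) ∈ globalAttractor γ A h β}

/-- `v(α) = (cos 2πα, sin 2πα)ᵗ`. -/
def vFull (α : ℝ) : R2 :=
  (WithLp.equiv 2 (Fin 2 → ℝ)).symm ![Real.cos (2 * Real.pi * α), Real.sin (2 * Real.pi * α)]

/-- `(cos πα, sin πα)ᵗ`, representing the projective point `α ∈ 𝕋 ≅ ℝP¹`. -/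
def vHalf (α : ℝ) : R2 :=
  (WithLp.equiv 2 (Fin 2 → ℝ)).symm ![Real.cos (Real.pi * α), Real.sin (Real.pi * α)]

/-- The projective angle coordinate `p(w) = (1/π)·arg(w) mod 1 ∈ [0,1)` of a nonzero
vector `w ∈ ℝ²`; for `w ≠ 0` this equals `(1/π)·arctan(w₂/w₁) mod 1`. -/
def projAngle (w : R2) : ℝ :=
  Int.fract (Complex.arg (Complex.ofReal (w 0) + Complex.ofReal (w 1) * Complex.I) / Real.pi)

/-- The projective action `g(θ,α) = (γθ, g_θ(α))` of the cocycle on `Θ × 𝕋`,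
where `𝕋` is modelled by the fundamental domain `[0,1) ⊆ ℝ`. -/
def gMap {Θ : Type*} (γ : Θ → Θ) (A : Θ → Matrix (Fin 2) (Fin 2) ℝ) :
    Θ × ℝ → Θ × ℝ :=
  fun p => (γ p.1, projAngle (mulVecE (A p.1) (vHalf p.2)))

/-- `Ω(θ,α) = ‖A(θ)(cos πα, sin πα)ᵗ‖`. -/
def Omega {Θ : Type*} (A : Θ → Matrix (Fin 2) (Fin 2) ℝ) (p : Θ × ℝ) : ℝ :=
  ‖mulVecE (A p.1) (vHalf p.2)‖

/-- The fibre maps `F_{β,θ,α}(r) = h(βr)·Ω(θ,α)` of the double skew product. -/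
def dsFib {Θ : Type*} (A : Θ → Matrix (Fin 2) (Fin 2) ℝ) (h : ℝ → ℝ) (β : ℝ)
    (p : Θ × ℝ) (r : ℝ) : ℝ :=
  h (β * r) * Omega A p

/-- The double skew product `F_β(θ,α,r) = (g(θ,α), h(βr)·Ω(θ,α))` on `Θ × 𝕋 × [0,∞)`. -/
def dsMap {Θ : Type*} (γ : Θ → Θ) (A : Θ → Matrix (Fin 2) (Fin 2) ℝ) (h : ℝ → ℝ)
    (β : ℝ) : Θ × ℝ × ℝ → Θ × ℝ × ℝ :=
  fun p => ((gMap γ A (p.1, p.2.1)).1, (gMap γ A (p.1, p.2.1)).2, dsFib A h β (p.1, p.2.1) p.2.2)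

/-- `Ω_n(θ,α) = ∏_{i=0}^{n-1} Ω(g^i(θ,α))`. -/
def OmegaProd {Θ : Type*} (γ : Θ → Θ) (A : Θ → Matrix (Fin 2) (Fin 2) ℝ) (n : ℕ)
    (p : Θ × ℝ) : ℝ :=
  ∏ i ∈ Finset.range n, Omega A ((gMap γ A)^[i] p)

/-- `Γ(a,b) = inf_{a ≤ x ≤ 1} inf_{0 < q ≤ b} h(qx)/(q·h(x))`. -/
def GammaH (h : ℝ → ℝ) (a b : ℝ) : ℝ :=
  sInf {y : ℝ | ∃ x ∈ Set.Icc a 1, ∃ q ∈ Set.Ioc (0 : ℝ) b, y = h (q * x) / (q * h x)}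

/-- The inverse `g⁻¹(θ,α) = (γ⁻¹θ, projective angle of A(γ⁻¹θ)⁻¹·v(α))` of the
projective action. -/
def gInv {Θ : Type*} (γinv : Θ → Θ) (A : Θ → Matrix (Fin 2) (Fin 2) ℝ) :
    Θ × ℝ → Θ × ℝ :=
  fun p => (γinv p.1, projAngle (mulVecE (A (γinv p.1))⁻¹ (vHalf p.2)))

/-- `F^n_{β,g^{-n}(θ,α)}(1)`, the pullback iterate defining the upper bounding graph. -/
def pullback1 {Θ : Type*} (γ : Θ → Θ) (γinv : Θ → Θ) (A : Θ → Matrix (Fin 2) (Fin 2) ℝ)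
    (h : ℝ → ℝ) (β : ℝ) (n : ℕ) (p : Θ × ℝ) : ℝ :=
  ((dsMap γ A h β)^[n] (((gInv γinv A)^[n] p).1, ((gInv γinv A)^[n] p).2, 1)).2.2

lemma mulVecE_eq_toEuclideanCLM (M : Matrix (Fin 2) (Fin 2) ℝ) (v : R2) :
    mulVecE M v = (Matrix.toEuclideanCLM (𝕜 := ℝ) M : R2 →L[ℝ] R2) v := rfl

lemma norm_mulVecE_le (M : Matrix (Fin 2) (Fin 2) ℝ) (v : R2) :
    ‖mulVecE M v‖ ≤ opNorm M * ‖v‖ :=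
  (Matrix.toEuclideanCLM (𝕜 := ℝ) M : R2 →L[ℝ] R2).le_opNorm v

lemma opNorm_nonneg (M : Matrix (Fin 2) (Fin 2) ℝ) : 0 ≤ opNorm M := norm_nonneg _

lemma opNorm_one_le : opNorm 1 ≤ 1 := by
  unfold opNorm
  rw [map_one]
  exact ContinuousLinearMap.norm_id_le

lemma opNorm_mul_le (M N : Matrix (Fin 2) (Fin 2) ℝ) :
    opNorm (M * N) ≤ opNorm M * opNorm N := by
  unfold opNorm
  rw [map_mul]
  exact norm_mul_le _ _

lemma continuous_opNorm : Continuous opNorm := by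
  have hc : Continuous fun M : Matrix (Fin 2) (Fin 2) ℝ =>
      (Matrix.toEuclideanCLM (𝕜 := ℝ) M : R2 →L[ℝ] R2) :=
    (Matrix.toEuclideanCLM (n := Fin 2)
      (𝕜 := ℝ)).toAlgEquiv.toLinearMap.continuous_of_finiteDimensional
  exact hc.norm

lemma one_le_opNorm_of_det_eq_one {M : Matrix (Fin 2) (Fin 2) ℝ} (hM : M.det = 1) :
    1 ≤ opNorm M := by
  have hcol (j : Fin 2) : M 0 j ^ 2 + M 1 j ^ 2 ≤ opNorm M ^ 2 := by
    have hle := norm_mulVecE_le M (EuclideanSpace.single j 1)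
    rw [PiLp.norm_single, norm_one, mul_one] at hle
    have hsq := pow_le_pow_left₀ (norm_nonneg _) hle 2
    rw [EuclideanSpace.norm_sq_eq] at hsq
    simpa [mulVecE, Fin.sum_univ_two] using hsq
  rw [Matrix.det_fin_two] at hM
  have h0 := hcol 0
  have h1 := hcol 1
  refine (one_le_sq_iff₀ (opNorm_nonneg M)).1 ?_
  nlinarith [sq_nonneg (M 0 0 - M 1 1), sq_nonneg (M 0 1 + M 1 0)]

section Cocycle

variable {Θ : Type*} {γ : Θ → Θ} {A : Θ → Matrix (Fin 2) (Fin 2) ℝ}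

lemma coc_add (m n : ℕ) (θ : Θ) : coc γ A (m + n) θ = coc γ A m (γ^[n] θ) * coc γ A n θ := by
  induction n generalizing θ with
  | zero => simp [coc]
  | succ n ih => rw [← add_assoc, coc, ih, coc, Function.iterate_succ_apply, mul_assoc]

lemma det_coc (hdet : ∀ θ, (A θ).det = 1) (n : ℕ) (θ : Θ) : (coc γ A n θ).det = 1 := by
  induction n generalizing θ with
  | zero => simp [coc]
  | succ n ih => rw [coc, Matrix.det_mul, ih, hdet, mul_one]

lemma continuous_coc [TopologicalSpace Θ] (hγ : Continuous γ) (hA : Continuous A) (n : ℕ) :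
    Continuous (coc γ A n) := by
  induction n with
  | zero => exact continuous_const
  | succ n ih => exact (ih.comp hγ).mul hA

lemma opNorm_coc_le_pow {K : ℝ} (hK : ∀ θ, opNorm (A θ) ≤ K) (n : ℕ) (θ : Θ) :
    opNorm (coc γ A n θ) ≤ K ^ n := by
  induction n generalizing θ with
  | zero => simpa [coc] using opNorm_one_le
  | succ n ih =>
    rw [coc, pow_succ]
    have hK0 : 0 ≤ K := (opNorm_nonneg _).trans (hK θ)
    exact (opNorm_mul_le _ _).trans (mul_le_mul (ih _) (hK θ) (opNorm_nonneg _) (by positivity))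

lemma exists_opNorm_le [TopologicalSpace Θ] [CompactSpace Θ] (hA : Continuous A) :
    ∃ K : ℝ, 1 ≤ K ∧ ∀ θ, opNorm (A θ) ≤ K := by
  obtain ⟨K, hK⟩ := (isCompact_range (continuous_opNorm.comp hA)).bddAbove
  exact ⟨max 1 K, le_max_left _ _, fun θ => (hK ⟨θ, rfl⟩).trans (le_max_right _ _)⟩

lemma eventually_opNorm_coc_lt_exp (hdet : ∀ θ, (A θ).det = 1) {K : ℝ} (hK1 : 1 ≤ K)
    (hK : ∀ θ, opNorm (A θ) ≤ K) {c : ℝ} (hc : lyapMax γ A < c) (θ : Θ) :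
    ∀ᶠ n : ℕ in atTop, opNorm (coc γ A n θ) < Real.exp (c * n) := by
  have hone (n : ℕ) (θ : Θ) : 1 ≤ opNorm (coc γ A n θ) :=
    one_le_opNorm_of_det_eq_one (det_coc hdet n θ)
  have hupper (θ : Θ) (n : ℕ) : Real.log (opNorm (coc γ A n θ)) / n ≤ Real.log K := by
    refine div_le_of_le_mul₀ n.cast_nonneg (Real.log_nonneg hK1) ?_
    rw [mul_comm, ← Real.log_pow]
    exact Real.log_le_log (zero_lt_one.trans_le (hone n θ)) (opNorm_coc_le_pow hK n θ)
  have hlower (θ : Θ) (n : ℕ) : 0 ≤ Real.log (opNorm (coc γ A n θ)) / n :=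
    div_nonneg (Real.log_nonneg (hone n θ)) n.cast_nonneg
  have hbdd : BddAbove (range fun θ : Θ =>
      limsup (fun n : ℕ => Real.log (opNorm (coc γ A n θ)) / n) atTop) := by
    refine ⟨Real.log K, ?_⟩
    rintro _ ⟨θ, rfl⟩
    exact limsup_le_of_le (isCoboundedUnder_le_of_le atTop (hlower θ))
      (Eventually.of_forall (hupper θ))
  have hlt := eventually_lt_of_limsup_lt ((le_ciSup hbdd θ).trans_lt hc)
    (isBoundedUnder_of ⟨Real.log K, hupper θ⟩)
  filter_upwards [hlt, eventually_gt_atTop 0] with n hn hn0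
  rw [div_lt_iff₀ (Nat.cast_pos.2 hn0)] at hn
  exact (Real.log_lt_iff_lt_exp (zero_lt_one.trans_le (hone n θ))).1 hn

/-- If every orbit contracts by `1 / 2` at some positive time, the contraction is uniform. -/
lemma tendsto_pow_mul_opNorm_coc [TopologicalSpace Θ] [CompactSpace Θ] (hγ : Continuous γ)
    (hA : Continuous A) {β : ℝ} (hβ : 0 < β)
    (hsmall : ∀ θ, ∃ n, 0 < n ∧ β ^ n * opNorm (coc γ A n θ) < 1 / 2) :
    ∃ u : ℕ → ℝ, Tendsto u atTop (𝓝 0) ∧ ∀ n θ, β ^ n * opNorm (coc γ A n θ) ≤ u n := by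
  choose k hk0 hk using hsmall
  obtain ⟨t, ht⟩ := CompactSpace.elim_nhds_subcover
    (fun θ => {η | β ^ k θ * opNorm (coc γ A (k θ) η) < 1 / 2}) fun θ =>
      (isOpen_lt (continuous_const.mul (continuous_opNorm.comp (continuous_coc hγ hA (k θ))))
        continuous_const).mem_nhds (hk θ)
  have hN : ∃ N : ℕ, 0 < N ∧ ∀ θ, ∃ n, 0 < n ∧ n ≤ N ∧ β ^ n * opNorm (coc γ A n θ) < 1 / 2 := by
    refine ⟨t.sup k + 1, by omega, fun θ => ?_⟩
    have hθ : θ ∈ (⊤ : Set Θ) := trivial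
    rw [← ht] at hθ
    obtain ⟨η, hη, hmem⟩ := mem_iUnion₂.1 hθ
    exact ⟨k η, hk0 η, (Finset.le_sup hη).trans (Nat.le_succ _), hmem⟩
  obtain ⟨N, hN0, hN⟩ := hN
  obtain ⟨K, hK1, hK⟩ := exists_opNorm_le hA
  set C := max 1 (β * K)
  have hC1 : 1 ≤ C := le_max_left _ _
  refine ⟨fun n => C ^ N * (1 / 2) ^ (n / N), ?_, fun n => ?_⟩
  · have hhalf : Tendsto (fun n : ℕ => (1 / 2 : ℝ) ^ (n / N)) atTop (𝓝 0) :=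
      (tendsto_pow_atTop_nhds_zero_of_lt_one (by norm_num) (by norm_num)).comp
        (Nat.tendsto_div_const_atTop hN0.ne')
    simpa using hhalf.const_mul (C ^ N)
  · beta_reduce
    induction n using Nat.strong_induction_on with
    | _ m ih =>
      intro θ
      rcases lt_or_ge m N with hm | hm
      · rw [Nat.div_eq_of_lt hm, pow_zero, mul_one]
        calc β ^ m * opNorm (coc γ A m θ) ≤ β ^ m * K ^ m := by
              gcongr; exact opNorm_coc_le_pow hK m θ
          _ = (β * K) ^ m := (mul_pow _ _ _).symm
          _ ≤ C ^ m := by gcongr; exact le_max_right _ _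
          _ ≤ C ^ N := pow_le_pow_right₀ hC1 hm.le
      · obtain ⟨n, hn0, hnN, hn⟩ := hN θ
        obtain ⟨l, rfl⟩ := Nat.exists_eq_add_of_le' (hnN.trans hm)
        have hdiv : (l + n) / N ≤ l / N + 1 := by
          rw [← Nat.add_div_right l hN0]
          exact Nat.div_le_div_right (by omega)
        calc β ^ (l + n) * opNorm (coc γ A (l + n) θ)
            ≤ β ^ (l + n) * (opNorm (coc γ A l (γ^[n] θ)) * opNorm (coc γ A n θ)) := by
              rw [coc_add]; gcongr; exact opNorm_mul_le _ _
          _ = (β ^ l * opNorm (coc γ A l (γ^[n] θ))) * (β ^ n * opNorm (coc γ A n θ)) := by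
              ring
          _ ≤ (C ^ N * (1 / 2) ^ (l / N)) * (1 / 2) :=
              mul_le_mul (ih l (by omega) _) hn.le
                (mul_nonneg (by positivity) (opNorm_nonneg _)) (by positivity)
          _ = C ^ N * (1 / 2) ^ (l / N + 1) := by ring
          _ ≤ C ^ N * (1 / 2) ^ ((l + n) / N) := by
              gcongr ?_ * ?_
              exact pow_le_pow_of_le_one (by norm_num) (by norm_num) hdiv

end Cocycle

lemma GoodH.le_self {h : ℝ → ℝ} (hh : GoodH h) {x : ℝ} (hx : 0 ≤ x) : h x ≤ x := by
  obtain ⟨-, -, hconc, -, -, h0, hderiv⟩ := hh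
  rcases hx.eq_or_lt with rfl | hx
  · exact h0.le
  have hdiff : DifferentiableWithinAt ℝ h (Ici 0) 0 :=
    differentiableWithinAt_of_derivWithin_ne_zero (by rw [hderiv]; exact one_ne_zero)
  have hslope := hconc.concaveOn.slope_le_of_hasDerivWithinAt self_mem_Ici hx.le hx
    hdiff.hasDerivWithinAt
  rwa [hderiv, slope_def_field, h0, sub_zero, sub_zero, div_le_one hx] at hslope

section SkewProduct

variable {Θ : Type*} {γ : Θ → Θ} {A : Θ → Matrix (Fin 2) (Fin 2) ℝ} {h : ℝ → ℝ} {β : ℝ}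

lemma exists_fibMap_eq_smul (hh : GoodH h) (hβ : 0 < β) (θ : Θ) (v : R2) :
    ∃ c : ℝ, 0 ≤ c ∧ c ≤ β ∧ fibMap A h β θ v = c • mulVecE (A θ) v := by
  by_cases hv : v = 0
  · exact ⟨0, le_rfl, hβ.le, by simp [fibMap, hv]⟩
  · have hpos : 0 < ‖v‖ := norm_pos_iff.2 hv
    have hβv : 0 ≤ β * ‖v‖ := by positivity
    refine ⟨h (β * ‖v‖) / ‖v‖, div_nonneg (hh.2.2.2.2.1 _ hβv) hpos.le, ?_, by
      rw [fibMap, if_neg hv]⟩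
    exact (div_le_iff₀ hpos).2 (hh.le_self hβv)

lemma exists_iterate_skewProd_eq_smul (hh : GoodH h) (hβ : 0 < β) (n : ℕ) (θ : Θ) (v : R2) :
    ∃ c : ℝ, 0 ≤ c ∧ c ≤ β ^ n ∧
      ((skewProd γ A h β)^[n] (θ, v)).2 = c • mulVecE (coc γ A n θ) v := by
  induction n generalizing θ v with
  | zero => exact ⟨1, zero_le_one, by simp, by simp [coc, mulVecE_eq_toEuclideanCLM]⟩
  | succ n ih =>
    obtain ⟨c, hc0, hc, hcv⟩ := exists_fibMap_eq_smul (A := A) hh hβ θ v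
    obtain ⟨d, hd0, hd, hdv⟩ := ih (γ θ) (fibMap A h β θ v)
    refine ⟨d * c, mul_nonneg hd0 hc0, ?_, ?_⟩
    · rw [pow_succ]
      exact mul_le_mul hd hc hc0 (by positivity)
    · rw [Function.iterate_succ_apply, skewProd, hdv, hcv, coc]
      simp only [mulVecE_eq_toEuclideanCLM, map_mul, map_smul, smul_smul,
        mul_apply_eq_comp]

lemma norm_iterate_skewProd_le (hh : GoodH h) (hβ : 0 < β) (n : ℕ) (θ : Θ) (v : R2) :
    ‖((skewProd γ A h β)^[n] (θ, v)).2‖ ≤ β ^ n * opNorm (coc γ A n θ) * ‖v‖ := by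
  obtain ⟨c, hc0, hc, hcv⟩ := exists_iterate_skewProd_eq_smul (γ := γ) (A := A) hh hβ n θ v
  rw [hcv, norm_smul, Real.norm_of_nonneg hc0, mul_assoc]
  exact mul_le_mul hc (norm_mulVecE_le _ _) (norm_nonneg _) (by positivity)

lemma iterate_skewProd_zero (n : ℕ) (θ : Θ) :
    (skewProd γ A h β)^[n] (θ, 0) = (γ^[n] θ, 0) := by
  induction n generalizing θ with
  | zero => rfl
  | succ n ih => simp [Function.iterate_succ_apply, skewProd, fibMap, ih]

end SkewProduct

/-- If `β < β₁ = e^{-λ_max(A)}`, the global attractor of the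
deterministically forced system equals the zero section `Θ × {0}`. -/
theorem stmt0 {Θ : Type*} [MetricSpace Θ] [CompactSpace Θ]
    (γ : Θ ≃ₜ Θ)
    (A : Θ → Matrix (Fin 2) (Fin 2) ℝ) (hdet : ∀ θ, (A θ).det = 1) (hA : Continuous A)
    (h : ℝ → ℝ) (hh : GoodH h) (hscale : Scaled A h)
    (β : ℝ) (hβpos : 0 < β) (hβ : β < Real.exp (-(lyapMax ⇑γ A))) :
    globalAttractor ⇑γ A h β = Set.univ ×ˢ ({0} : Set R2) := by
  obtain ⟨c, hc, hβc⟩ : ∃ c, lyapMax γ A < c ∧ β * Real.exp c < 1 := by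
    have hlog : Real.log β < -lyapMax γ A := (Real.log_lt_iff_lt_exp hβpos).2 hβ
    obtain ⟨c, hc1, hc2⟩ := exists_between (lt_neg_of_lt_neg hlog)
    refine ⟨c, hc1, ?_⟩
    rw [← Real.exp_log hβpos, ← Real.exp_add, Real.exp_lt_one_iff]
    linarith
  obtain ⟨K, hK1, hK⟩ := exists_opNorm_le hA
  have hsmall (θ : Θ) : ∃ n, 0 < n ∧ β ^ n * opNorm (coc γ A n θ) < 1 / 2 := by
    have hpow := (tendsto_pow_atTop_nhds_zero_of_lt_one (by positivity) hβc).eventually_lt_const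
      (show (0 : ℝ) < 1 / 2 by norm_num)
    obtain ⟨n, hn0, hn, hlt⟩ := ((eventually_gt_atTop 0).and
      ((eventually_opNorm_coc_lt_exp hdet hK1 hK hc θ).and hpow)).exists
    refine ⟨n, hn0, lt_of_le_of_lt ?_ hlt⟩
    rw [mul_pow, ← Real.exp_nat_mul, mul_comm (n : ℝ)]
    gcongr
  obtain ⟨u, hu, hle⟩ := tendsto_pow_mul_opNorm_coc γ.continuous hA hβpos hsmall
  ext ⟨θ, x⟩
  simp only [globalAttractor, mem_iInter, mem_image, mem_prod, mem_univ, true_and,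
    mem_singleton_iff, mem_closedBall_zero_iff, Prod.exists]
  refine ⟨fun hx => ?_, ?_⟩
  · refine norm_le_zero_iff.1 (ge_of_tendsto' hu fun n => ?_)
    obtain ⟨η, v, hv, heq⟩ := hx n
    have hnorm := norm_iterate_skewProd_le (γ := γ) (A := A) hh hβpos n η v
    rw [heq] at hnorm
    exact hnorm.trans ((mul_le_of_le_one_right
      (mul_nonneg (by positivity) (opNorm_nonneg _)) hv).trans (hle n η))
  · rintro rfl n
    refine ⟨γ.symm^[n] θ, 0, by simp, ?_⟩
    rw [iterate_skewProd_zero, (Function.LeftInverse.iterate γ.apply_symm_apply n) θ]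
end
end

section
/- Suppose β₁ < β < β₂ (so in particular λ_max(A) > 0). Then there exists at least one θ* ∈ Θ such that the fibre 𝒜_β(θ*) of the global attractor is a line segment of positive length: there are a unit vector u ∈ ℝ² and a constant c > 0 with 𝒜_β(θ*) = {r·u : r ∈ [−c, c]}. -/
open Filter MeasureTheory Metric Set
open scoped Topology

noncomputable section

/-- The continuous linear map of Euclidean ℝ² given by a 2×2 matrix. -/
abbrev toCLM (M : Matrix (Fin 2) (Fin 2) ℝ) : R2 →L[ℝ] R2 :=
  Matrix.toEuclideanCLM (𝕜 := ℝ) M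

theorem toCLM_mul_apply (M N : Matrix (Fin 2) (Fin 2) ℝ) (v : R2) :
    toCLM (M * N) v = toCLM M (toCLM N v) := by
  simp [toCLM, map_mul]

theorem toCLM_apply_zero (M : Matrix (Fin 2) (Fin 2) ℝ) (v : R2) :
    toCLM M v 0 = M 0 0 * v 0 + M 0 1 * v 1 := by
  simp [toCLM, Matrix.ofLp_toEuclideanCLM, Matrix.mulVec, dotProduct, Fin.sum_univ_two]

theorem toCLM_apply_one (M : Matrix (Fin 2) (Fin 2) ℝ) (v : R2) :
    toCLM M v 1 = M 1 0 * v 0 + M 1 1 * v 1 := by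
  simp [toCLM, Matrix.ofLp_toEuclideanCLM, Matrix.mulVec, dotProduct, Fin.sum_univ_two]

theorem toCLM_adjugate_apply {M : Matrix (Fin 2) (Fin 2) ℝ} (hM : M.det = 1) (v : R2) :
    toCLM M.adjugate (toCLM M v) = v := by
  rw [← toCLM_mul_apply, Matrix.adjugate_mul, hM, one_smul]
  simp [toCLM]

theorem toCLM_apply_adjugate {M : Matrix (Fin 2) (Fin 2) ℝ} (hM : M.det = 1) (v : R2) :
    toCLM M (toCLM M.adjugate v) = v := by
  rw [← toCLM_mul_apply, Matrix.mul_adjugate, hM, one_smul]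
  simp [toCLM]

theorem continuous_toCLM_apply {X : Type*} [TopologicalSpace X]
    {M : X → Matrix (Fin 2) (Fin 2) ℝ} (hM : Continuous M) {v : X → R2} (hv : Continuous v) :
    Continuous fun x => toCLM (M x) (v x) := by
  have hv' : Continuous fun x => (v x).ofLp := (PiLp.continuous_ofLp 2 _).comp hv
  exact (PiLp.continuous_toLp 2 _).comp (hM.matrix_mulVec hv')

/-- The determinant of the pair `(x, y)`. -/
def wedge (x y : R2) : ℝ := x 0 * y 1 - x 1 * y 0

theorem wedge_toCLM (M : Matrix (Fin 2) (Fin 2) ℝ) (x y : R2) :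
    wedge (toCLM M x) (toCLM M y) = M.det * wedge x y := by
  simp only [wedge, toCLM_apply_zero, toCLM_apply_one, Matrix.det_fin_two]
  ring

theorem abs_wedge_le (x y : R2) : |wedge x y| ≤ ‖x‖ * ‖y‖ := by
  refine abs_le_of_sq_le_sq ?_ (by positivity)
  rw [mul_pow, EuclideanSpace.norm_sq_eq, EuclideanSpace.norm_sq_eq]
  simp only [Fin.sum_univ_two, Real.norm_eq_abs, sq_abs, wedge]
  nlinarith [sq_nonneg (x 0 * y 0 + x 1 * y 1)]

theorem exists_smul_of_wedge_eq_zero {u x : R2} (hu : ‖u‖ = 1) (hx : wedge u x = 0) :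
    ∃ r : ℝ, x = r • u := by
  have h1 : u 0 ^ 2 + u 1 ^ 2 = 1 := by
    have := EuclideanSpace.norm_sq_eq u
    simp only [Fin.sum_univ_two, Real.norm_eq_abs, sq_abs, hu] at this
    linarith
  unfold wedge at hx
  refine ⟨u 0 * x 0 + u 1 * x 1, ?_⟩
  ext i
  fin_cases i
  · simp only [Fin.zero_eta, PiLp.smul_apply, smul_eq_mul]
    linear_combination (-x 0) * h1 - u 1 * hx
  · simp only [Fin.mk_one, PiLp.smul_apply, smul_eq_mul]
    linear_combination (-x 1) * h1 + u 0 * hx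

namespace GoodH

variable {h : ℝ → ℝ}

theorem continuousOn (hh : GoodH h) : ContinuousOn h (Ici 0) := hh.1.continuousOn

theorem map_zero (hh : GoodH h) : h 0 = 0 := hh.2.2.2.2.2.1

theorem nonneg (hh : GoodH h) {x : ℝ} (hx : 0 ≤ x) : 0 ≤ h x := hh.2.2.2.2.1 x hx

theorem hasDerivWithinAt (hh : GoodH h) : HasDerivWithinAt h 1 (Ici 0) 0 := by
  have := (hh.1.differentiableOn (by norm_num) 0 self_mem_Ici).hasDerivWithinAt
  rwa [hh.2.2.2.2.2.2] at this

theorem le_self_s1 (hh : GoodH h) {x : ℝ} (hx : 0 ≤ x) : h x ≤ x := by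
  rcases hx.eq_or_lt with rfl | hx
  · exact hh.map_zero.le
  have := hh.2.2.1.concaveOn.slope_le_of_hasDerivWithinAt (x := 0) (y := x)
    self_mem_Ici hx.le hx hh.hasDerivWithinAt
  rw [slope_def_field, hh.map_zero, sub_zero, sub_zero, div_le_one hx] at this
  exact this

theorem exists_mul_le (hh : GoodH h) {k : ℝ} (hk : k < 1) :
    ∃ δ > 0, ∀ x, 0 ≤ x → x ≤ δ → k * x ≤ h x := by
  have h1 := (hh.hasDerivWithinAt.isLittleO).def (sub_pos.2 hk)
  rw [eventually_nhdsWithin_iff, Metric.eventually_nhds_iff] at h1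
  obtain ⟨ε, hε, H⟩ := h1
  refine ⟨ε / 2, half_pos hε, fun x hx hxe => ?_⟩
  have := H (y := x) (by rw [Real.dist_eq, sub_zero, abs_of_nonneg hx]; linarith) hx
  simp only [sub_zero, hh.map_zero, smul_eq_mul, mul_one, Real.norm_eq_abs,
    abs_of_nonneg hx] at this
  linarith [(abs_le.1 this).1]

end GoodH

section Dynamics

variable {Θ : Type*} {A : Θ → Matrix (Fin 2) (Fin 2) ℝ} {h : ℝ → ℝ} {β : ℝ}

theorem fibMap_eq (θ : Θ) (v : R2) :
    fibMap A h β θ v = (h (β * ‖v‖) / ‖v‖) • toCLM (A θ) v := by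
  unfold fibMap
  split_ifs with hv
  · simp [hv]
  · rfl

theorem fibMap_neg (θ : Θ) (v : R2) : fibMap A h β θ (-v) = -fibMap A h β θ v := by
  simp [fibMap_eq]

theorem fibMap_zero (θ : Θ) : fibMap A h β θ 0 = 0 := by simp [fibMap]

theorem fibMap_smul (hh : GoodH h) (θ : Θ) (v : R2) {s : ℝ} (hs : 0 ≤ s) :
    fibMap A h β θ (s • v) = (h (β * (s * ‖v‖)) / ‖v‖) • toCLM (A θ) v := by
  rcases hs.eq_or_lt with rfl | hs
  · simp [fibMap_zero, hh.map_zero]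
  · rw [fibMap_eq, norm_smul, Real.norm_of_nonneg hs.le, map_smul, smul_smul]
    congr 1
    field_simp

theorem ratio_nonneg (hh : GoodH h) (hβ : 0 ≤ β) {t : ℝ} (ht : 0 ≤ t) : 0 ≤ h (β * t) / t :=
  div_nonneg (hh.nonneg (by positivity)) ht

theorem ratio_le (hh : GoodH h) (hβ : 0 ≤ β) {t : ℝ} (ht : 0 ≤ t) : h (β * t) / t ≤ β :=
  div_le_of_le_mul₀ ht hβ (hh.le_self_s1 (by positivity))

theorem continuous_fibMap (hh : GoodH h) (hβ : 0 ≤ β) (θ : Θ) :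
    Continuous (fibMap A h β θ) := by
  have hfun : fibMap A h β θ = fun v => (h (β * ‖v‖) / ‖v‖) • toCLM (A θ) v :=
    funext (fibMap_eq θ)
  rw [continuous_iff_continuousAt]
  intro v
  by_cases hv : v = 0
  · subst hv
    rw [ContinuousAt, fibMap_zero]
    have h0 : Tendsto (fun v : R2 => β * ‖toCLM (A θ) v‖) (𝓝 0) (𝓝 0) := by
      have : Continuous fun v : R2 => β * ‖toCLM (A θ) v‖ := by fun_prop
      simpa using this.tendsto 0
    refine squeeze_zero_norm (fun v => ?_) h0
    rw [fibMap_eq, norm_smul, Real.norm_of_nonneg (ratio_nonneg hh hβ (norm_nonneg v))]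
    exact mul_le_mul_of_nonneg_right (ratio_le hh hβ (norm_nonneg v)) (norm_nonneg _)
  · have hc : Continuous fun v : R2 => h (β * ‖v‖) :=
      hh.continuousOn.comp_continuous (by fun_prop) fun v => mem_Ici.2 (by positivity)
    rw [hfun]
    exact (hc.continuousAt.div continuous_norm.continuousAt (norm_ne_zero_iff.2 hv)).smul
      (toCLM (A θ)).continuous.continuousAt

variable {γ : Θ → Θ}

/-- The fibre over `θ` of `f_β^n(Θ × B̄₁(0))`, where `δ` is the inverse of the base map. -/
def iterFib (δ : Θ → Θ) (A : Θ → Matrix (Fin 2) (Fin 2) ℝ) (h : ℝ → ℝ) (β : ℝ) :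
    ℕ → Θ → Set R2
  | 0, _ => closedBall 0 1
  | n + 1, θ => fibMap A h β (δ θ) '' iterFib δ A h β n (δ θ)

theorem iterate_skewProd_image (γ : Θ ≃ Θ) (n : ℕ) :
    (skewProd γ A h β)^[n] '' (univ ×ˢ closedBall (0 : R2) 1) =
      {p | p.2 ∈ iterFib γ.symm A h β n p.1} := by
  induction n with
  | zero => ext p; simp [iterFib]
  | succ n ih =>
    rw [Function.iterate_succ', image_comp, ih]
    ext ⟨θ, x⟩
    constructor
    · rintro ⟨⟨θ', y⟩, hy, hxy⟩
      obtain ⟨rfl, rfl⟩ := Prod.mk.inj hxy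
      exact ⟨y, by simpa using hy, by simp⟩
    · rintro ⟨y, hy, hyx⟩
      exact ⟨(γ.symm θ, y), hy, Prod.ext (γ.apply_symm_apply θ) hyx⟩

theorem attractorFib_eq_iInter (γ : Θ ≃ Θ) (θ : Θ) :
    attractorFib γ A h β θ = ⋂ n, iterFib γ.symm A h β n θ := by
  ext x
  simp [attractorFib, globalAttractor, iterate_skewProd_image]

variable {δ : Θ → Θ}

theorem isCompact_iterFib (hh : GoodH h) (hβ : 0 ≤ β) (n : ℕ) (θ : Θ) :
    IsCompact (iterFib δ A h β n θ) := by
  induction n generalizing θ with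
  | zero => exact isCompact_closedBall 0 1
  | succ n ih => exact (ih _).image (continuous_fibMap hh hβ _)

theorem neg_mem_iterFib {n : ℕ} {θ : Θ} {x : R2} (hx : x ∈ iterFib δ A h β n θ) :
    -x ∈ iterFib δ A h β n θ := by
  induction n generalizing θ x with
  | zero => simpa [iterFib] using hx
  | succ n ih =>
    obtain ⟨y, hy, rfl⟩ := hx
    exact ⟨-y, ih hy, fibMap_neg _ _⟩

theorem smul_mem_iterFib (hh : GoodH h) (hβ : 0 ≤ β) {n : ℕ} {θ : Θ} {x : R2}
    (hx : x ∈ iterFib δ A h β n θ) {t : ℝ} (ht : t ∈ Icc (0 : ℝ) 1) :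
    t • x ∈ iterFib δ A h β n θ := by
  induction n generalizing θ x t with
  | zero =>
    simp only [iterFib, mem_closedBall_zero_iff] at hx ⊢
    rw [norm_smul, Real.norm_of_nonneg ht.1]
    exact mul_le_one₀ ht.2 (norm_nonneg x) hx
  | succ n ih =>
    obtain ⟨y, hy, rfl⟩ := hx
    have hc : ContinuousOn (fun s => h (β * (s * ‖y‖))) (Icc (0 : ℝ) 1) :=
      hh.continuousOn.comp (by fun_prop) fun s hs => mem_Ici.2 (by have := hs.1; positivity)
    obtain ⟨s, hs, hst⟩ := intermediate_value_Icc zero_le_one hc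
      (show t * h (β * ‖y‖) ∈ _ by
        have := hh.nonneg (x := β * ‖y‖) (by positivity)
        simp only [zero_mul, mul_zero, one_mul, hh.map_zero]
        exact ⟨mul_nonneg ht.1 this, mul_le_of_le_one_left this ht.2⟩)
    refine ⟨s • y, ih hy hs, ?_⟩
    simp only at hst
    rw [fibMap_smul hh _ _ hs.1, hst, fibMap_eq, smul_smul, mul_div_assoc]

/-- The backward cocycle `A(δⁿθ)⁻¹ ⋯ A(δθ)⁻¹` applied to a vector, where `δ` is the inverse of
the base map. -/
def backCoc (δ : Θ → Θ) (A : Θ → Matrix (Fin 2) (Fin 2) ℝ) : ℕ → Θ → R2 → R2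
  | 0, _, v => v
  | n + 1, θ, v => backCoc δ A n (δ θ) (toCLM (A (δ θ)).adjugate v)

theorem backCoc_smul (n : ℕ) (θ : Θ) (c : ℝ) (v : R2) :
    backCoc δ A n θ (c • v) = c • backCoc δ A n θ v := by
  induction n generalizing θ v with
  | zero => rfl
  | succ n ih => rw [backCoc, map_smul, ih, backCoc]

theorem wedge_backCoc (hdet : ∀ θ, (A θ).det = 1) (n : ℕ) (θ : Θ) (x y : R2) :
    wedge (backCoc δ A n θ x) (backCoc δ A n θ y) = wedge x y := by
  induction n generalizing θ x y with
  | zero => rfl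
  | succ n ih =>
    rw [backCoc, backCoc, ih, wedge_toCLM, Matrix.det_adjugate, hdet, one_pow, one_mul]

theorem continuous_backCoc [TopologicalSpace Θ] (hA : Continuous A) (hδ : Continuous δ) (n : ℕ) :
    Continuous fun p : Θ × R2 => backCoc δ A n p.1 p.2 := by
  induction n with
  | zero => exact continuous_snd
  | succ n ih =>
    exact ih.comp ((hδ.comp continuous_fst).prodMk
      (continuous_toCLM_apply ((hA.comp (hδ.comp continuous_fst)).matrix_adjugate)
        continuous_snd))

theorem backCoc_orbit (hdet : ∀ θ, (A θ).det = 1) (hδ : Function.LeftInverse δ γ) {θ : Θ}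
    {w : ℕ → R2} (hw : ∀ j, w (j + 1) = toCLM (A (γ^[j] θ)) (w j)) (j m : ℕ) :
    backCoc δ A m (γ^[j + m] θ) (w (j + m)) = w j := by
  induction m with
  | zero => rfl
  | succ m ih =>
    rw [← add_assoc, Function.iterate_succ_apply', backCoc, hδ, hw, toCLM_adjugate_apply (hdet _),
      ih]

/-- Points of the iterated image are moved by the backward cocycle at rate at most `β`. -/
theorem norm_backCoc_le (hh : GoodH h) (hβ : 0 ≤ β) (hdet : ∀ θ, (A θ).det = 1) {n : ℕ} {θ : Θ}
    {x : R2} (hx : x ∈ iterFib δ A h β n θ) : ‖backCoc δ A n θ x‖ ≤ β ^ n := by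
  induction n generalizing θ x with
  | zero => simpa [iterFib, backCoc] using hx
  | succ n ih =>
    obtain ⟨y, hy, rfl⟩ := hx
    rw [backCoc, fibMap_eq, map_smul, toCLM_adjugate_apply (hdet _), backCoc_smul, norm_smul,
      Real.norm_of_nonneg (ratio_nonneg hh hβ (norm_nonneg y)), pow_succ']
    exact mul_le_mul (ratio_le hh hβ (norm_nonneg y)) (ih hy) (norm_nonneg _) hβ

/-- A vector contracted fast enough by the backward cocycle lies in the iterated image. -/
theorem mem_iterFib_of_norm_backCoc_le (hh : GoodH h) (hβ : 0 ≤ β) (hdet : ∀ θ, (A θ).det = 1)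
    {κ t₀ : ℝ} (hκ : 0 < κ) (ht₀ : t₀ ≤ 1) (hκh : ∀ t, 0 ≤ t → t ≤ t₀ → κ * t ≤ h (β * t))
    {n : ℕ} {θ : Θ} {x : R2} (hx : ∀ j, ‖backCoc δ A j θ x‖ ≤ κ ^ j * t₀) :
    x ∈ iterFib δ A h β n θ := by
  induction n generalizing θ x with
  | zero =>
    have := hx 0
    simp only [backCoc, pow_zero, one_mul] at this
    simpa [iterFib] using this.trans ht₀
  | succ n ih =>
    have hy (j : ℕ) :
        ‖backCoc δ A j (δ θ) (κ⁻¹ • toCLM (A (δ θ)).adjugate x)‖ ≤ κ ^ j * t₀ := by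
      have := hx (j + 1)
      rw [backCoc] at this
      rw [backCoc_smul, norm_smul, Real.norm_of_nonneg (inv_nonneg.2 hκ.le), inv_mul_le_iff₀ hκ,
        ← mul_assoc, ← pow_succ']
      exact this
    set y := κ⁻¹ • toCLM (A (δ θ)).adjugate x with hydef
    have hf : fibMap A h β (δ θ) y ∈ iterFib δ A h β (n + 1) θ := ⟨y, ih hy, rfl⟩
    have hAy : toCLM (A (δ θ)) y = κ⁻¹ • x := by
      rw [hydef, map_smul, toCLM_apply_adjugate (hdet _)]
    by_cases hy0 : y = 0
    · have : x = 0 := by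
        rw [hy0, map_zero] at hAy
        exact (smul_eq_zero.1 hAy.symm).resolve_left (inv_ne_zero hκ.ne')
      rw [hy0, fibMap_zero] at hf
      rwa [this]
    have hyn : 0 < ‖y‖ := norm_pos_iff.2 hy0
    have hyt : ‖y‖ ≤ t₀ := by simpa [backCoc] using hy 0
    have hr : κ ≤ h (β * ‖y‖) / ‖y‖ := (le_div_iff₀ hyn).2 (hκh _ hyn.le hyt)
    have hr0 := hκ.trans_le hr
    have := smul_mem_iterFib hh hβ hf (t := κ / (h (β * ‖y‖) / ‖y‖))
      ⟨by positivity, (div_le_one hr0).2 hr⟩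
    rw [fibMap_eq, hAy, smul_smul, smul_smul] at this
    rwa [div_mul_cancel₀ _ hr0.ne', mul_inv_cancel₀ hκ.ne', one_smul] at this

/-- If some direction over `θ` is contracted by the backward cocycle at rate `σ⁻¹` with
`σ⁻¹ < β < σ`, then the fibre of the attractor over `θ` is a segment in that direction. -/
theorem attractorFib_eq_segment (γ : Θ ≃ Θ) (hh : GoodH h) (hdet : ∀ θ, (A θ).det = 1)
    {σ : ℝ} (hσ : 0 < σ) (hσβ : σ⁻¹ < β) (hβσ : β < σ) {θ : Θ} {u : R2} (hu : ‖u‖ = 1)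
    (hθ : ∀ m, ‖backCoc γ.symm A m θ u‖ ≤ σ⁻¹ ^ m) :
    ∃ c : ℝ, 0 < c ∧ attractorFib γ A h β θ = (fun r : ℝ => r • u) '' Icc (-c) c := by
  have hβ : 0 < β := (inv_pos.2 hσ).trans hσβ
  have hmem {x : R2} : x ∈ attractorFib γ A h β θ ↔ ∀ n, x ∈ iterFib γ.symm A h β n θ := by
    rw [attractorFib_eq_iInter, mem_iInter]
  have hline {x : R2} (hx : x ∈ attractorFib γ A h β θ) : ∃ r : ℝ, x = r • u := by
    refine exists_smul_of_wedge_eq_zero hu ?_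
    have hle (n : ℕ) : |wedge u x| ≤ (σ⁻¹ * β) ^ n := by
      rw [← wedge_backCoc (δ := γ.symm) hdet n θ, mul_pow]
      exact (abs_wedge_le _ _).trans (mul_le_mul (hθ n)
        (norm_backCoc_le hh hβ.le hdet (hmem.1 hx n)) (norm_nonneg _) (by positivity))
    have hlim : Tendsto (fun n : ℕ => (σ⁻¹ * β) ^ n) atTop (𝓝 0) :=
      tendsto_pow_atTop_nhds_zero_of_lt_one (by positivity) (by
        rw [inv_mul_lt_iff₀ hσ]; linarith)
    exact abs_nonpos_iff.1 (ge_of_tendsto' hlim hle)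
  obtain ⟨t₀, ht₀, ht₀u⟩ : ∃ t₀ : ℝ, 0 < t₀ ∧ t₀ • u ∈ attractorFib γ A h β θ := by
    obtain ⟨δ, hδ, hδh⟩ := hh.exists_mul_le (k := σ⁻¹ * β⁻¹) (by
      rw [← div_eq_mul_inv, div_lt_one hβ]; exact hσβ)
    refine ⟨min 1 (δ / β), by positivity, hmem.2 fun n => ?_⟩
    refine mem_iterFib_of_norm_backCoc_le hh hβ.le hdet (inv_pos.2 hσ) (min_le_left _ (δ / β))
      (fun t ht htδ => ?_) fun j => ?_
    · have := hδh (β * t) (by positivity)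
        ((le_div_iff₀' hβ).1 (htδ.trans (min_le_right _ _)))
      rwa [← mul_assoc, inv_mul_cancel_right₀ hβ.ne'] at this
    · rw [backCoc_smul, norm_smul, mul_comm, Real.norm_of_nonneg (by positivity)]
      exact mul_le_mul_of_nonneg_right (hθ j) (by positivity)
  have hcompact : IsCompact {r : ℝ | r • u ∈ attractorFib γ A h β θ} := by
    refine Metric.isCompact_of_isClosed_isBounded ?_ ?_
    · rw [attractorFib_eq_iInter]
      exact (isClosed_iInter fun n => (isCompact_iterFib hh hβ.le n θ).isClosed).preimage
        (by fun_prop)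
    · refine (isBounded_closedBall (x := (0 : ℝ)) (r := 1)).subset fun r hr => ?_
      have := hmem.1 hr 0
      simpa [iterFib, norm_smul, hu] using this
  obtain ⟨c, hc, hcmax⟩ := hcompact.exists_isGreatest ⟨t₀, ht₀u⟩
  have hc0 : 0 < c := ht₀.trans_le (hcmax ht₀u)
  refine ⟨c, hc0, Subset.antisymm (fun x hx => ?_) ?_⟩
  · obtain ⟨r, rfl⟩ := hline hx
    refine ⟨r, ⟨?_, hcmax hx⟩, rfl⟩
    have : -r ≤ c := hcmax (show (-r) • u ∈ _ by
      rw [neg_smul]; exact hmem.2 fun n => neg_mem_iterFib (hmem.1 hx n))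
    linarith
  · have hpos {r : ℝ} (hr : 0 ≤ r) (hrc : r ≤ c) (n : ℕ) :
        r • u ∈ iterFib γ.symm A h β n θ := by
      have := smul_mem_iterFib hh hβ.le (hmem.1 hc n) (t := r / c)
        ⟨by positivity, (div_le_one hc0).2 hrc⟩
      rwa [smul_smul, div_mul_cancel₀ _ hc0.ne'] at this
    rintro _ ⟨r, ⟨hr1, hr2⟩, rfl⟩
    refine hmem.2 fun n => ?_
    rcases le_total 0 r with hr | hr
    · exact hpos hr hr2 n
    · have := neg_mem_iterFib (hpos (neg_nonneg.2 hr) (by linarith) n)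
      simpa using this

theorem coc_succ' (γ : Θ → Θ) (A : Θ → Matrix (Fin 2) (Fin 2) ℝ) (n : ℕ) (θ : Θ) :
    coc γ A (n + 1) θ = A (γ^[n] θ) * coc γ A n θ := by
  induction n generalizing θ with
  | zero => simp [coc]
  | succ n ih => rw [coc, ih, coc, ← mul_assoc, Function.iterate_succ_apply]

theorem exists_frequently_lt_opNorm_coc {s : ℝ} (hs : 0 < s) (hlt : s < lyapMax γ A) :
    ∃ θ, ∃ᶠ n : ℕ in atTop, Real.exp s ^ n < opNorm (coc γ A n θ) := by
  have : Nonempty Θ := by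
    by_contra hne
    rw [not_nonempty_iff] at hne
    rw [lyapMax, Real.iSup_of_isEmpty] at hlt
    linarith
  obtain ⟨θ, hθ⟩ := exists_lt_of_lt_ciSup hlt
  refine ⟨θ, ?_⟩
  have hfreq : ∃ᶠ n : ℕ in atTop, s < Real.log (opNorm (coc γ A n θ)) / n := by
    by_contra hcon
    rw [not_frequently] at hcon
    have hmem : s ∈ {a : ℝ | ∀ᶠ n : ℕ in atTop, Real.log (opNorm (coc γ A n θ)) / n ≤ a} :=
      hcon.mono fun n hn => not_lt.1 hn
    rw [limsup_eq] at hθ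
    by_cases hb : BddBelow {a : ℝ | ∀ᶠ n : ℕ in atTop, Real.log (opNorm (coc γ A n θ)) / n ≤ a}
    · exact hθ.not_ge (csInf_le hb hmem)
    · rw [Real.sInf_of_not_bddBelow hb] at hθ
      linarith
  refine (hfreq.and_eventually (eventually_gt_atTop 0)).mono fun n ⟨hn, hn0⟩ => ?_
  have hn0' : (0 : ℝ) < n := Nat.cast_pos.2 hn0
  rw [lt_div_iff₀ hn0'] at hn
  have hlog : 0 < Real.log (opNorm (coc γ A n θ)) := lt_trans (by positivity) hn
  have hpos : 0 < opNorm (coc γ A n θ) := by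
    refine (norm_nonneg _).lt_of_ne fun h0 => ?_
    rw [opNorm, ← h0, Real.log_zero] at hlog
    exact hlog.false
  rw [← Real.exp_nat_mul, mul_comm]
  exact (Real.lt_log_iff_exp_lt hpos).1 hn

/-- Along a long orbit segment with large expansion, the time at which the expansion relative to
`σⁿ` is maximal yields a direction contracted at rate `σ⁻¹` by the backward cocycle. -/
theorem exists_contracted_direction_upTo (γ : Θ ≃ Θ) (hdet : ∀ θ, (A θ).det = 1) {C : ℝ}
    (hC : ∀ θ, opNorm (A θ) ≤ C) {s σ : ℝ} (hσ : 0 < σ) (hσs : σ < Real.exp s) (hs : 0 < s)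
    (hlt : s < lyapMax γ A) (M : ℕ) :
    ∃ θ : Θ, ∃ v : R2, ‖v‖ = 1 ∧ ∀ m ≤ M, ‖backCoc γ.symm A m θ v‖ ≤ σ⁻¹ ^ m := by
  obtain ⟨θ, hθ⟩ := exists_frequently_lt_opNorm_coc hs hlt
  set D : ℝ := max 1 (C / σ)
  have hlim : Tendsto (fun n : ℕ => (Real.exp s / σ) ^ n) atTop atTop :=
    tendsto_pow_atTop_atTop_of_one_lt ((one_lt_div hσ).2 hσs)
  obtain ⟨n, hn, hnD⟩ := (hθ.and_eventually (hlim.eventually_ge_atTop (D ^ M))).exists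
  obtain ⟨w, hw1, hwn⟩ := ContinuousLinearMap.exists_lt_apply_of_lt_opNorm _ hn
  set x : ℕ → R2 := fun j => toCLM (coc γ A j θ) w with hxdef
  have hx (j : ℕ) : x (j + 1) = toCLM (A (γ^[j] θ)) (x j) := by
    simp only [hxdef]
    rw [coc_succ', toCLM_mul_apply]
  have hxD (j : ℕ) : ‖x j‖ / σ ^ j ≤ D ^ j := by
    induction j with
    | zero =>
      have : x 0 = w := by simp [hxdef, coc, toCLM]
      simpa [this] using hw1.le
    | succ j ih =>
      have h1 : ‖x (j + 1)‖ ≤ C * ‖x j‖ := by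
        rw [hx]
        exact ((toCLM _).le_opNorm _).trans
          (mul_le_mul_of_nonneg_right (hC _) (norm_nonneg _))
      calc ‖x (j + 1)‖ / σ ^ (j + 1) ≤ C * ‖x j‖ / σ ^ (j + 1) := by gcongr
        _ = C / σ * (‖x j‖ / σ ^ j) := by rw [pow_succ']; field_simp
        _ ≤ D * D ^ j := mul_le_mul (le_max_right _ _) ih (by positivity) (by positivity)
        _ = D ^ (j + 1) := (pow_succ' _ _).symm
  obtain ⟨j, hjn, hjmax⟩ := Finset.exists_max_image (Finset.range (n + 1))
    (fun j => ‖x j‖ / σ ^ j) ⟨0, by simp⟩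
  have hDn : D ^ M < ‖x n‖ / σ ^ n := by
    refine hnD.trans_lt ?_
    rw [div_pow]
    exact div_lt_div_of_pos_right hwn (by positivity)
  have hMj : M < j := by
    by_contra! hjM
    have h1 := (hjmax n (by simp)).trans (hxD j)
    have h2 : D ^ j ≤ D ^ M := pow_le_pow_right₀ (le_max_left _ _) hjM
    linarith
  have hxj : 0 < ‖x j‖ := by
    have h1 : 0 < ‖x j‖ / σ ^ j :=
      lt_of_lt_of_le (lt_trans (by positivity) hDn) (hjmax n (by simp))
    by_contra! h0
    exact h1.not_ge (div_nonpos_of_nonpos_of_nonneg h0 (by positivity))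
  refine ⟨γ^[j] θ, ‖x j‖⁻¹ • x j, ?_, fun m hm => ?_⟩
  · rw [norm_smul, norm_inv, norm_norm, inv_mul_cancel₀ hxj.ne']
  · obtain ⟨i, rfl⟩ : ∃ i, j = i + m := ⟨j - m, by omega⟩
    rw [backCoc_smul, backCoc_orbit hdet γ.symm_apply_apply hx, norm_smul, norm_inv, norm_norm,
      inv_mul_le_iff₀ hxj]
    have h1 := hjmax i (by simp at hjn ⊢; omega)
    rw [div_le_div_iff₀ (by positivity) (by positivity), pow_add, mul_left_comm, mul_comm] at h1
    rw [inv_pow, ← div_eq_mul_inv, le_div_iff₀ (by positivity)]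
    refine le_of_mul_le_mul_left ?_ (pow_pos hσ i)
    linarith

theorem exists_contracted_direction [TopologicalSpace Θ] [T2Space Θ] [CompactSpace Θ] (γ : Θ ≃ₜ Θ)
    (hdet : ∀ θ, (A θ).det = 1) (hA : Continuous A) {s σ : ℝ} (hσ : 0 < σ)
    (hσs : σ < Real.exp s) (hs : 0 < s) (hlt : s < lyapMax γ A) :
    ∃ θ : Θ, ∃ v : R2, ‖v‖ = 1 ∧ ∀ m, ‖backCoc γ.symm A m θ v‖ ≤ σ⁻¹ ^ m := by
  obtain ⟨C, hC⟩ : ∃ C, ∀ θ, opNorm (A θ) ≤ C := by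
    have hc : Continuous fun θ => opNorm (A θ) :=
      (LinearMap.continuous_of_finiteDimensional
        (Matrix.toEuclideanCLM (𝕜 := ℝ) (n := Fin 2)).toAlgEquiv.toLinearMap).norm.comp hA
    obtain ⟨C, hC⟩ := (isCompact_range hc).bddAbove
    exact ⟨C, fun θ => hC (mem_range_self θ)⟩
  let K : ℕ → Set (Θ × R2) := fun M =>
    (univ ×ˢ sphere 0 1) ∩ ⋂ m ≤ M, {p | ‖backCoc γ.symm A m p.1 p.2‖ ≤ σ⁻¹ ^ m}
  have hclosed (M : ℕ) : IsClosed (⋂ m ≤ M,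
      {p : Θ × R2 | ‖backCoc γ.symm A m p.1 p.2‖ ≤ σ⁻¹ ^ m}) :=
    isClosed_biInter fun m _ =>
      isClosed_le (continuous_backCoc hA γ.symm.continuous m).norm continuous_const
  have hcompact (M : ℕ) : IsCompact (K M) :=
    (isCompact_univ.prod (isCompact_sphere 0 1)).inter_right (hclosed M)
  obtain ⟨p, hp⟩ := IsCompact.nonempty_iInter_of_sequence_nonempty_isCompact_isClosed K
    (fun M => inter_subset_inter_right _
      (biInter_subset_biInter_left fun m hm => Nat.le_succ_of_le hm))
    (fun M => by
      obtain ⟨θ, v, hv, hm⟩ :=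
        exists_contracted_direction_upTo γ.toEquiv hdet hC hσ hσs hs hlt M
      exact ⟨(θ, v), ⟨mem_univ _, by simpa using hv⟩, by simpa using hm⟩)
    (hcompact 0) fun M => (hcompact M).isClosed
  rw [mem_iInter] at hp
  refine ⟨p.1, p.2, by simpa using (hp 0).1.2, fun m => ?_⟩
  have := (hp m).2
  simp only [mem_iInter] at this
  exact this m le_rfl

end Dynamics

/-- If `β₁ < β < β₂`, there is at least one `θ*` whose attractor fibre
is a line segment of positive length. -/
theorem stmt1 {Θ : Type*} [MetricSpace Θ] [CompactSpace Θ]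
    (γ : Θ ≃ₜ Θ)
    (A : Θ → Matrix (Fin 2) (Fin 2) ℝ) (hdet : ∀ θ, (A θ).det = 1) (hA : Continuous A)
    (h : ℝ → ℝ) (hh : GoodH h) (hscale : Scaled A h)
    (β : ℝ) (hβ1 : Real.exp (-(lyapMax ⇑γ A)) < β) (hβ2 : β < Real.exp (lyapMax ⇑γ A)) :
    ∃ θ : Θ, ∃ u : R2, ‖u‖ = 1 ∧ ∃ c : ℝ, 0 < c ∧
      attractorFib ⇑γ A h β θ = (fun r : ℝ => r • u) '' Set.Icc (-c) c := by
  have hβ : 0 < β := (Real.exp_pos _).trans hβ1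
  have hβ1' : -lyapMax γ A < Real.log β := (Real.lt_log_iff_exp_lt hβ).2 hβ1
  have hβ2' : Real.log β < lyapMax γ A := (Real.log_lt_iff_lt_exp hβ).2 hβ2
  obtain ⟨s', hs', hs'lt⟩ := exists_between (abs_lt.2 ⟨hβ1', hβ2'⟩)
  obtain ⟨s, hs, hss'⟩ := exists_between hs'
  obtain ⟨hs1, hs2⟩ := abs_lt.1 hs
  obtain ⟨θ, u, hu, hθ⟩ := exists_contracted_direction γ hdet hA (Real.exp_pos s)
    (Real.exp_lt_exp.2 hss') ((abs_nonneg _).trans_lt hs') hs'lt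
  refine ⟨θ, u, hu, attractorFib_eq_segment γ.toEquiv hh hdet (Real.exp_pos s) ?_ ?_ hu hθ⟩
  · rw [← Real.exp_neg]
    exact (Real.lt_log_iff_exp_lt hβ).1 hs1
  · exact (Real.log_lt_iff_lt_exp hβ).1 hs2
end
end
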